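/- For any n ≥ 2 and any family Z : Fin n → Finset α, the unconfoundedness score equals 0 if and only if all the sets are equal and nonempty, i.e., UC(Z) = 0 ↔ ((∀ i j, Z i = Z j) ∧ ∀ i, (Z i).Nonempty). In particular, if all generative factors share the same nonempty set of latent factors, the UC score is 0. -/

import Mathlib

open Finset

/-- Jaccard similarity coefficient of two finite sets, as a real number.
By the convention of real division, `jaccard A B = 0` when `A ∪ B = ∅`. -/
noncomputable def jaccard {α : Type*} [DecidableEq α] (A B : Finset α) : ℝ :=
  ((A ∩ B).card : ℝ) / ((A ∪ B).card : ℝ)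

/-- Unconfoundedness (UC) score of a family `Z : Fin n → Finset α` of sets of
latent dimensions: `UC(Z) = 1 − (1 / (n choose 2)) · Σ_{i < j} J(Z i, Z j)`. -/
noncomputable def UC {α : Type*} [DecidableEq α] {n : ℕ} (Z : Fin n → Finset α) : ℝ :=
  1 - (1 / (n.choose 2 : ℝ)) *
    ∑ p ∈ Finset.univ.filter (fun p : Fin n × Fin n => p.1 < p.2), jaccard (Z p.1) (Z p.2)

theorem jaccard_le_one {α : Type*} [DecidableEq α] (A B : Finset α) : jaccard A B ≤ 1 :=
  div_le_one_of_le₀ (mod_cast card_le_card inter_subset_union) (Nat.cast_nonneg _)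

theorem jaccard_eq_one_iff {α : Type*} [DecidableEq α] {A B : Finset α} :
    jaccard A B = 1 ↔ A = B ∧ A.Nonempty := by
  constructor
  · intro h
    have hne : ((A ∪ B).card : ℝ) ≠ 0 := by
      intro h0
      simp [jaccard, h0] at h
    have hcard : (A ∩ B).card = (A ∪ B).card := by
      exact_mod_cast (div_eq_one_iff_eq hne).mp h
    have hsets : A ∩ B = A ∪ B := eq_of_subset_of_card_le inter_subset_union hcard.ge
    obtain rfl : A = B := inf_eq_sup.mp hsets
    refine ⟨rfl, ?_⟩
    rw [union_self] at hne
    exact card_ne_zero.mp (mod_cast hne)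
  · rintro ⟨rfl, hA⟩
    simp [jaccard, hA.ne_empty]

theorem UC_eq_zero_iff_forall_lt {α : Type*} [DecidableEq α] {n : ℕ} (hn : 2 ≤ n)
    (Z : Fin n → Finset α) :
    UC Z = 0 ↔ ∀ i j : Fin n, i < j → Z i = Z j ∧ (Z i).Nonempty := by
  have hpairs : (univ.filter fun p : Fin n × Fin n => p.1 < p.2).card = n.choose 2 := by
    simpa using card_product_filter_lt (s := (univ : Finset (Fin n)))
  have hchoose : (n.choose 2 : ℝ) ≠ 0 := mod_cast (Nat.choose_pos hn).ne'
  have hsum : (∑ _p ∈ univ.filter (fun p : Fin n × Fin n => p.1 < p.2), (1 : ℝ)) =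
      n.choose 2 := by
    rw [sum_const, hpairs, nsmul_one]
  rw [UC, sub_eq_zero, eq_comm, one_div_mul_eq_div, div_eq_one_iff_eq hchoose, ← hsum,
    sum_eq_sum_iff_of_le fun p _ => jaccard_le_one _ _]
  simp [jaccard_eq_one_iff]

/-- The UC score equals 0 iff all the latent sets are equal and nonempty. -/
theorem uc_eq_zero_iff_all_equal_nonempty {α : Type*} [DecidableEq α] {n : ℕ} (hn : 2 ≤ n)
    (Z : Fin n → Finset α) :
    UC Z = 0 ↔ ((∀ i j : Fin n, Z i = Z j) ∧ ∀ i : Fin n, (Z i).Nonempty) := by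
  rw [UC_eq_zero_iff_forall_lt hn]
  constructor
  · intro h
    have key : ∀ i j : Fin n, i ≠ j → Z i = Z j ∧ (Z i).Nonempty := by
      intro i j hij
      rcases lt_or_gt_of_ne hij with hlt | hgt
      · exact h i j hlt
      · obtain ⟨heq, hne⟩ := h j i hgt
        exact ⟨heq.symm, heq ▸ hne⟩
    have : Nontrivial (Fin n) := Fin.nontrivial_iff_two_le.mpr hn
    refine ⟨fun i j => ?_, fun i => ?_⟩
    · obtain rfl | hij := eq_or_ne i j
      · rfl
      · exact (key i j hij).1
    · obtain ⟨j, hj⟩ := exists_ne i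
      exact (key i j hj.symm).2
  · rintro ⟨heq, hne⟩ i j -
    exact ⟨heq i j, hne i⟩
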